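/- arXiv:2605.06631 — 6 statements merged into one kernel-verified Lean document; each statement's English description precedes it below -/
import Mathlib

section
/- Let μ be a probability measure on a measurable space Q, let 𝓑 be a set of budgets viewed as extended nonnegative reals, and for each b ∈ 𝓑 let d_b : Q → ℝ be a bounded measurable function. Let P and P' be finite measurable partitions of Q such that P' refines P, and for a finite measurable partition R define Δ_R(b) = max over cells F ∈ R with μ(F) > 0 of (1/μ(F)) ∫_F d_b dμ. Then for every ε ∈ ℝ: (i) {b ∈ 𝓑 : Δ_{P'}(b) ≤ ε} ⊆ {b ∈ 𝓑 : Δ_P(b) ≤ ε}; and (ii) the approval frontiers satisfy sInf {b ∈ 𝓑 : Δ_P(b) ≤ ε} ≤ sInf {b ∈ 𝓑 : Δ_{P'}(b) ≤ ε}, where the infima are taken in the extended nonnegative reals (so the infimum of the empty set is ∞). -/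
open MeasureTheory
open scoped ENNReal

/-- The partition-level family gap: the maximum, over cells `F` of the finite partition `R`
with `μ F > 0`, of the conditional mean `(1 / μ F) ∫_F d dμ`. -/
noncomputable def famGap {Q : Type*} [MeasurableSpace Q]
    (μ : Measure Q) (d : Q → ℝ) (R : Finset (Set Q)) : ℝ :=
  sSup ((fun F => (∫ q in F, d q ∂μ) / (μ F).toReal) '' {F : Set Q | F ∈ R ∧ 0 < μ F})

theorem famGap_mono_aux {Q : Type*} [MeasurableSpace Q]
    (μ : Measure Q) [IsProbabilityMeasure μ] (d : Q → ℝ)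
    (hdmeas : Measurable d) (hdbd : ∃ C, ∀ q, |d q| ≤ C)
    (P P' : Finset (Set Q))
    (hP'meas : ∀ G ∈ P', MeasurableSet G)
    (hPdisj : (P : Set (Set Q)).PairwiseDisjoint id)
    (hP'disj : (P' : Set (Set Q)).PairwiseDisjoint id)
    (hPcover : ⋃₀ (P : Set (Set Q)) = Set.univ)
    (hP'cover : ⋃₀ (P' : Set (Set Q)) = Set.univ)
    (href : ∀ G ∈ P', ∃ F ∈ P, G ⊆ F) :
    famGap μ d P ≤ famGap μ d P' := by
  classical
  obtain ⟨C, hC⟩ := hdbd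
  have hint : Integrable d μ :=
    Integrable.of_bound hdmeas.aestronglyMeasurable C
      (Filter.Eventually.of_forall fun q => by simpa using hC q)
  have hcell : ∀ G ∈ P', ∫ q in G, d q ∂μ ≤ famGap μ d P' * μ.real G := by
    intro G hG
    by_cases h0 : μ G = 0
    · rw [setIntegral_measure_zero _ h0]
      simp [Measure.real, h0]
    · have hpos : 0 < μ.real G := ENNReal.toReal_pos h0 (measure_ne_top μ G)
      rw [← div_le_iff₀ hpos]
      refine le_csSup ?_ ⟨G, ⟨hG, pos_iff_ne_zero.mpr h0⟩, rfl⟩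
      exact ((P'.finite_toSet.subset fun F hF => hF.1).image _).bddAbove
  have hne : ∃ F ∈ P, 0 < μ F := by
    by_contra! h
    have h1 : μ (⋃₀ (P : Set (Set Q))) = 0 :=
      (measure_sUnion_null_iff P.countable_toSet).2 fun F hF => le_antisymm (h F hF) bot_le
    rw [hPcover] at h1
    simp at h1
  unfold famGap
  refine csSup_le ?_ ?_
  · obtain ⟨F, hF, hpos⟩ := hne
    exact ⟨_, F, ⟨hF, hpos⟩, rfl⟩
  · rintro _ ⟨F, ⟨hF, hFpos⟩, rfl⟩
    change _ ≤ famGap μ d P'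
    have hpos : 0 < μ.real F := ENNReal.toReal_pos hFpos.ne' (measure_ne_top μ F)
    have hU : F = ⋃ G ∈ P'.filter (fun G => G ⊆ F), G := by
      ext q
      simp only [Set.mem_iUnion, Finset.mem_filter]
      constructor
      · intro hq
        have hq' : q ∈ ⋃₀ (P' : Set (Set Q)) := hP'cover ▸ Set.mem_univ q
        obtain ⟨G, hG, hqG⟩ := hq'
        obtain ⟨F', hF', hGF⟩ := href G hG
        have : F' = F := hPdisj.elim_set hF' hF q (hGF hqG) hq
        exact ⟨G, ⟨hG, this ▸ hGF⟩, hqG⟩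
      · rintro ⟨G, ⟨_, hGF⟩, hqG⟩
        exact hGF hqG
    have hm : ∀ G ∈ P'.filter (fun G => G ⊆ F), MeasurableSet G :=
      fun G hG => hP'meas G (Finset.mem_filter.1 hG).1
    have hd : ((P'.filter (fun G => G ⊆ F) : Finset (Set Q)) : Set (Set Q)).PairwiseDisjoint id :=
      hP'disj.subset fun G hG => (Finset.mem_filter.1 hG).1
    have hI : ∫ q in F, d q ∂μ = ∑ G ∈ P'.filter (fun G => G ⊆ F), ∫ q in G, d q ∂μ := by
      conv_lhs => rw [hU]
      exact integral_biUnion_finset _ hm hd fun G _ => hint.integrableOn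
    have hM : μ.real F = ∑ G ∈ P'.filter (fun G => G ⊆ F), μ.real G := by
      conv_lhs => rw [hU]
      exact measureReal_biUnion_finset hd hm
    change _ / μ.real F ≤ _
    rw [div_le_iff₀ hpos, hI, hM, Finset.mul_sum]
    exact Finset.sum_le_sum fun G hG => hcell G (Finset.mem_filter.1 hG).1

/-- **Budget consequence of partition refinement.** For budgets `𝓑 ⊆ ℝ≥0∞`, per-budget
bounded measurable excess risks `d b`, and finite measurable partitions `P`, `P'` with `P'`
refining `P`: the feasible budget set of the fine partition is contained in that of the coarse
partition, and the coarse approval frontier (infimum of feasible budgets, `∞` if none) is at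
most the fine approval frontier. -/
theorem frontier_refinement {Q : Type*} [MeasurableSpace Q]
    (μ : Measure Q) [IsProbabilityMeasure μ]
    (𝓑 : Set ℝ≥0∞) (d : ℝ≥0∞ → Q → ℝ)
    (hdmeas : ∀ b, Measurable (d b)) (hdbd : ∀ b, ∃ C, ∀ q, |d b q| ≤ C)
    (P P' : Finset (Set Q))
    (hPmeas : ∀ F ∈ P, MeasurableSet F) (hP'meas : ∀ G ∈ P', MeasurableSet G)
    (hPdisj : (P : Set (Set Q)).PairwiseDisjoint id)
    (hP'disj : (P' : Set (Set Q)).PairwiseDisjoint id)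
    (hPcover : ⋃₀ (P : Set (Set Q)) = Set.univ)
    (hP'cover : ⋃₀ (P' : Set (Set Q)) = Set.univ)
    (href : ∀ G ∈ P', ∃ F ∈ P, G ⊆ F)
    (ε : ℝ) :
    {b ∈ 𝓑 | famGap μ (d b) P' ≤ ε} ⊆ {b ∈ 𝓑 | famGap μ (d b) P ≤ ε} ∧
    sInf {b ∈ 𝓑 | famGap μ (d b) P ≤ ε} ≤ sInf {b ∈ 𝓑 | famGap μ (d b) P' ≤ ε} := by
  have h : {b ∈ 𝓑 | famGap μ (d b) P' ≤ ε} ⊆ {b ∈ 𝓑 | famGap μ (d b) P ≤ ε} :=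
    fun b hb => ⟨hb.1, (famGap_mono_aux μ (d b) (hdmeas b) (hdbd b) P P' hP'meas hPdisj
      hP'disj hPcover hP'cover href).trans hb.2⟩
  exact ⟨h, sInf_le_sInf h⟩
end

section
/- Let m be a natural number, σsq : Fin m → ℝ with σsq j > 0 for all j, α : Fin m → ℝ with α j ≥ 0 for all j, ε > 0, and ν > 0. Define the reverse water-filling allocation d* : Fin m → ℝ by d* j = σsq j if α j = 0, and d* j = min(σsq j, ν / α j) if α j > 0, and assume ∑_j α j · d* j = ε. Then d* is feasible (0 < d* j ≤ σsq j for all j) and optimal for the weighted Gaussian allocation program: for every d : Fin m → ℝ with 0 < d j ≤ σsq j for all j and ∑_j α j · d j ≤ ε, one has (1/2) ∑_j log(σsq j / d* j) ≤ (1/2) ∑_j log(σsq j / d j). -/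
/-- **Weighted reverse water-filling optimality.** With variances `σsq j > 0`, weights
`α j ≥ 0`, tolerance `ε > 0` and water level `ν > 0`, the reverse water-filling allocation
`d* j = σsq j` if `α j = 0` and `d* j = min (σsq j) (ν / α j)` otherwise, assumed to satisfy
the active constraint `∑ j, α j * d* j = ε`, is feasible and minimizes the Gaussian rate
`(1/2) ∑ j, log (σsq j / d j)` over all feasible allocations. -/
theorem reverse_water_filling_optimal (m : ℕ) (σsq α : Fin m → ℝ)
    (hσ : ∀ j, 0 < σsq j) (hα : ∀ j, 0 ≤ α j)
    (ε ν : ℝ) (hε : 0 < ε) (hν : 0 < ν)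
    (dstar : Fin m → ℝ)
    (hdstar : ∀ j, dstar j = if α j = 0 then σsq j else min (σsq j) (ν / α j))
    (hactive : ∑ j, α j * dstar j = ε) :
    (∀ j, 0 < dstar j ∧ dstar j ≤ σsq j) ∧
    (∀ d : Fin m → ℝ, (∀ j, 0 < d j ∧ d j ≤ σsq j) → (∑ j, α j * d j ≤ ε) →
      (1 / 2) * ∑ j, Real.log (σsq j / dstar j) ≤ (1 / 2) * ∑ j, Real.log (σsq j / d j)) := by
  have hfeas : ∀ j, 0 < dstar j ∧ dstar j ≤ σsq j := by
    intro j
    rw [hdstar j]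
    split_ifs with h
    · exact ⟨hσ j, le_refl _⟩
    · have hp : 0 < α j := lt_of_le_of_ne (hα j) (Ne.symm h)
      exact ⟨lt_min (hσ j) (div_pos hν hp), min_le_left _ _⟩
  refine ⟨hfeas, fun d hd hc => ?_⟩
  have key : ∀ j, Real.log (σsq j / dstar j) ≤
      Real.log (σsq j / d j) + (α j * d j - α j * dstar j) / ν := by
    intro j
    obtain ⟨hs, hs'⟩ := hfeas j
    obtain ⟨hd0, hd1⟩ := hd j
    rw [Real.log_div (hσ j).ne' hs.ne', Real.log_div (hσ j).ne' hd0.ne']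
    have h1 := Real.log_le_sub_one_of_pos (div_pos hd0 hs)
    rw [Real.log_div hd0.ne' hs.ne'] at h1
    have hprod : (d j - dstar j) * (ν - α j * dstar j) ≤ 0 := by
      have hj := hdstar j
      split_ifs at hj with h
      · rw [h, hj]
        nlinarith
      · have hp : 0 < α j := lt_of_le_of_ne (hα j) (Ne.symm h)
        rcases le_total (σsq j) (ν / α j) with hle | hle
        · rw [min_eq_left hle] at hj
          rw [hj]
          have h2 := (le_div_iff₀ hp).1 hle
          exact mul_nonpos_of_nonpos_of_nonneg (by linarith) (by linarith)
        · rw [min_eq_right hle] at hj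
          have h2 : α j * dstar j = ν := by rw [hj]; field_simp
          rw [h2]; simp
    have h2 : d j / dstar j - 1 ≤ (α j * d j - α j * dstar j) / ν := by
      rw [div_sub_one hs.ne', div_le_div_iff₀ hs hν]
      nlinarith
    linarith
  have hsum := Finset.sum_le_sum (fun j (_ : j ∈ Finset.univ) => key j)
  rw [Finset.sum_add_distrib, ← Finset.sum_div, Finset.sum_sub_distrib, hactive] at hsum
  have h3 : (∑ j, α j * d j - ε) / ν ≤ 0 :=
    div_nonpos_of_nonpos_of_nonneg (by linarith) hν.le
  linarith
end

section
/- Let m and r be natural numbers, σsq : Fin m → ℝ with σsq j > 0 for all j, 𝒬 a finite set of queries, α : 𝒬 → Fin m → ℝ with α q j ≥ 0, and ε > 0. Suppose the coordinates and queries are block-decoupled: there are maps β : Fin m → Fin r and γ : 𝒬 → Fin r such that α q j = 0 whenever γ q ≠ β j. Let S = { d : Fin m → ℝ | ∀ j, 0 < d j ≤ σsq j, and ∀ q ∈ 𝒬, ∑_j α q j · d j ≤ ε }, and for each block ℓ ∈ Fin r let S_ℓ = { d : Fin m → ℝ | ∀ j with β j = ℓ, 0 < d j ≤ σsq j, and ∀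 q ∈ 𝒬 with γ q = ℓ, ∑_{j : β j = ℓ} α q j · d j ≤ ε }. Then the optimal total Gaussian rate decomposes additively over blocks: inf_{d ∈ S} (1/2) ∑_j log(σsq j / d j) = ∑_{ℓ} inf_{d ∈ S_ℓ} (1/2) ∑_{j : β j = ℓ} log(σsq j / d j), where all infima are over nonempty sets of functions and the objectives are nonnegative (log the natural logarithm). -/
/-- **Factor relevance decomposition.** When coordinates and queries are block-decoupled
(`α q j = 0` whenever `γ q ≠ β j`), the optimal Gaussian rate over the jointly feasible set
decomposes additively over blocks: the infimum of `(1/2) ∑ j, log (σsq j / d j)` over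
allocations feasible for every query equals the sum over blocks `l` of the infimum of the
blockwise rate over blockwise feasible allocations. -/
theorem factor_relevance_decomposition (m r : ℕ)
    (σsq : Fin m → ℝ) (hσ : ∀ j, 0 < σsq j)
    {𝒬 : Type*} [Fintype 𝒬]
    (α : 𝒬 → Fin m → ℝ) (hα : ∀ q j, 0 ≤ α q j)
    (ε : ℝ) (hε : 0 < ε)
    (β : Fin m → Fin r) (γ : 𝒬 → Fin r)
    (hblock : ∀ q j, γ q ≠ β j → α q j = 0) :
    sInf ((fun d : Fin m → ℝ => (1 / 2) * ∑ j, Real.log (σsq j / d j)) ''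
        {d | (∀ j, 0 < d j ∧ d j ≤ σsq j) ∧ ∀ q : 𝒬, ∑ j, α q j * d j ≤ ε})
      = ∑ l : Fin r,
        sInf ((fun d : Fin m → ℝ =>
            (1 / 2) * ∑ j ∈ Finset.univ.filter (fun j => β j = l), Real.log (σsq j / d j)) ''
          {d | (∀ j, β j = l → 0 < d j ∧ d j ≤ σsq j) ∧
            ∀ q : 𝒬, γ q = l →
              ∑ j ∈ Finset.univ.filter (fun j => β j = l), α q j * d j ≤ ε}) := by
  have hq : ∀ (q : 𝒬) (x : Fin m → ℝ),
      ∑ j, α q j * x j = ∑ j ∈ Finset.univ.filter (fun j => β j = γ q), α q j * x j := by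
    intro q x
    rw [Finset.sum_filter]
    refine Finset.sum_congr rfl fun j _ => ?_
    split_ifs with h
    · rfl
    · rw [hblock q j (fun h' => h h'.symm), zero_mul]
  have hsplit : ∀ x : Fin m → ℝ, (1 / 2 : ℝ) * ∑ j, Real.log (σsq j / x j)
      = ∑ l : Fin r, (1 / 2) * ∑ j ∈ Finset.univ.filter (fun j => β j = l),
          Real.log (σsq j / x j) := by
    intro x
    rw [← Finset.mul_sum, Finset.sum_fiberwise]
  -- a jointly feasible allocation
  obtain ⟨d₀, hd₀, hd₀q⟩ : ∃ d : Fin m → ℝ, (∀ j, 0 < d j ∧ d j ≤ σsq j) ∧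
      ∀ q : 𝒬, ∑ j, α q j * d j ≤ ε := by
    have hnn : ∀ q, 0 ≤ ∑ j, α q j * σsq j := fun q =>
      Finset.sum_nonneg fun j _ => mul_nonneg (hα q j) (hσ j).le
    set C := ∑ q, ∑ j, α q j * σsq j with hC
    have hC0 : 0 ≤ C := Finset.sum_nonneg fun q _ => hnn q
    have hpos : 0 < ε + C := by linarith
    have ht : 0 < ε / (ε + C) := div_pos hε hpos
    have ht1 : ε / (ε + C) ≤ 1 := by rw [div_le_one hpos]; linarith
    refine ⟨fun j => ε / (ε + C) * σsq j, fun j => ⟨mul_pos ht (hσ j), ?_⟩, fun q => ?_⟩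
    · exact mul_le_of_le_one_left (hσ j).le ht1
    · have h1 : ∑ j, α q j * (ε / (ε + C) * σsq j) = ε / (ε + C) * ∑ j, α q j * σsq j := by
        rw [Finset.mul_sum]
        exact Finset.sum_congr rfl fun j _ => by ring
      have h2 : ∑ j, α q j * σsq j ≤ C :=
        Finset.single_le_sum (f := fun q => ∑ j, α q j * σsq j)
          (fun q _ => hnn q) (Finset.mem_univ q)
      rw [h1]
      calc ε / (ε + C) * ∑ j, α q j * σsq j ≤ ε / (ε + C) * (ε + C) :=
            mul_le_mul_of_nonneg_left (by linarith) ht.le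
        _ = ε := div_mul_cancel₀ _ hpos.ne'
  have hlog : ∀ (j : Fin m) (x : ℝ), 0 < x ∧ x ≤ σsq j → 0 ≤ Real.log (σsq j / x) :=
    fun j x hx => Real.log_nonneg ((one_le_div hx.1).2 hx.2)
  apply le_antisymm
  · refine le_of_forall_pos_le_add fun η hη => ?_
    have hδ : 0 < η / (r + 1) := by positivity
    have hch : ∀ l : Fin r, ∃ d : Fin m → ℝ, ((∀ j, β j = l → 0 < d j ∧ d j ≤ σsq j) ∧
        ∀ q : 𝒬, γ q = l →
          ∑ j ∈ Finset.univ.filter (fun j => β j = l), α q j * d j ≤ ε) ∧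
        (1 / 2) * ∑ j ∈ Finset.univ.filter (fun j => β j = l), Real.log (σsq j / d j) <
          sInf ((fun d : Fin m → ℝ =>
            (1 / 2) * ∑ j ∈ Finset.univ.filter (fun j => β j = l), Real.log (σsq j / d j)) ''
          {d | (∀ j, β j = l → 0 < d j ∧ d j ≤ σsq j) ∧
            ∀ q : 𝒬, γ q = l →
              ∑ j ∈ Finset.univ.filter (fun j => β j = l), α q j * d j ≤ ε}) + η / (r + 1) := by
      intro l
      obtain ⟨_, ⟨d, hd, rfl⟩, hlt⟩ := Real.lt_sInf_add_pos
        (s := (fun d : Fin m → ℝ =>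
            (1 / 2) * ∑ j ∈ Finset.univ.filter (fun j => β j = l), Real.log (σsq j / d j)) ''
          {d | (∀ j, β j = l → 0 < d j ∧ d j ≤ σsq j) ∧
            ∀ q : 𝒬, γ q = l →
              ∑ j ∈ Finset.univ.filter (fun j => β j = l), α q j * d j ≤ ε})
        ⟨_, d₀, ⟨fun j _ => hd₀ j, fun q hql => by
          have := hd₀q q
          rw [hq, hql] at this
          exact this⟩, rfl⟩ hδ
      exact ⟨d, hd, hlt⟩
    choose D hD hDlt using hch
    have hglue : ∀ l, ∀ j ∈ Finset.univ.filter (fun j => β j = l), D (β j) j = D l j := by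
      intro l j hj
      rw [(Finset.mem_filter.1 hj).2]
    have hle : sInf ((fun d : Fin m → ℝ => (1 / 2) * ∑ j, Real.log (σsq j / d j)) ''
        {d | (∀ j, 0 < d j ∧ d j ≤ σsq j) ∧ ∀ q : 𝒬, ∑ j, α q j * d j ≤ ε})
        ≤ (1 / 2) * ∑ j, Real.log (σsq j / D (β j) j) := by
      refine csInf_le ⟨0, ?_⟩ ⟨fun j => D (β j) j, ⟨fun j => (hD (β j)).1 j rfl, fun q => ?_⟩, rfl⟩
      · rintro _ ⟨d, hd, rfl⟩
        exact mul_nonneg (by norm_num) (Finset.sum_nonneg fun j _ => hlog j _ (hd.1 j))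
      · rw [hq q (fun j => D (β j) j)]
        refine le_trans (le_of_eq ?_) ((hD (γ q)).2 q rfl)
        exact Finset.sum_congr rfl fun j hj => by rw [hglue _ j hj]
    refine hle.trans ?_
    rw [hsplit (fun j => D (β j) j)]
    have heq : ∀ l : Fin r, (1 / 2 : ℝ) * ∑ j ∈ Finset.univ.filter (fun j => β j = l),
        Real.log (σsq j / D (β j) j) = (1 / 2 : ℝ) *
          ∑ j ∈ Finset.univ.filter (fun j => β j = l), Real.log (σsq j / D l j) := by
      intro l
      congr 1
      exact Finset.sum_congr rfl fun j hj => by rw [hglue _ j hj]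
    refine (Finset.sum_le_sum (fun l _ => (heq l).le.trans (hDlt l).le)).trans ?_
    · rw [Finset.sum_add_distrib]
      have : ∑ _l : Fin r, η / ((r : ℝ) + 1) ≤ η := by
        rw [Finset.sum_const, Finset.card_univ, Fintype.card_fin, nsmul_eq_mul, mul_div_assoc',
          div_le_iff₀ (by positivity)]
        nlinarith
      linarith
  · refine le_csInf ⟨_, d₀, ⟨hd₀, hd₀q⟩, rfl⟩ ?_
    rintro _ ⟨d, hd, rfl⟩
    change _ ≤ (1 / 2 : ℝ) * ∑ j, Real.log (σsq j / d j)
    rw [hsplit d]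
    refine Finset.sum_le_sum fun l _ => csInf_le ⟨0, ?_⟩ ⟨d, ⟨fun j _ => hd.1 j, ?_⟩, rfl⟩
    · rintro _ ⟨x, hx, rfl⟩
      exact mul_nonneg (by norm_num) (Finset.sum_nonneg fun j hj =>
        hlog j _ (hx.1 j (Finset.mem_filter.1 hj).2))
    · intro q hql
      have := hd.2 q
      rw [hq, hql] at this
      exact this
end

section
/- Let σ > 0 and 0 < ε < σ². Consider the objective F(d₁, d₂) = (1/2)·(log(σ²/d₁) + log(σ²/d₂)) (log the natural logarithm). Then: (i) the infimum of F over the set { (d₁, d₂) : 0 < d₁ ≤ σ², 0 < d₂ ≤ σ², d₁ ≤ ε, d₂ ≤ ε } equals log(σ²/ε); (ii) the infimum of F over the set { (d₁, d₂) : 0 < d₁ ≤ σ², 0 < d₂ ≤ σ², d₁ ≤ ε, d₂ ≤ ε, d₁ + d₂ ≤ ε } equals log(2σ²/ε); and (iii) the difference of the two infima equals log 2. -/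
/-- **Synergy penalty for joint-factor queries.** For `σ > 0` and `0 < ε < σ²`, the infimum
of the Gaussian rate `F (d₁, d₂) = (1/2) (log (σ²/d₁) + log (σ²/d₂))` over the separate-query
feasible set is `log (σ²/ε)`, over the joint-query feasible set (adding `d₁ + d₂ ≤ ε`) is
`log (2σ²/ε)`, and the difference of the two infima is exactly `log 2`. -/
theorem synergy_penalty (σ ε : ℝ) (hσ : 0 < σ) (hε : 0 < ε) (hεσ : ε < σ ^ 2) :
    sInf ((fun d : ℝ × ℝ => (1 / 2) * (Real.log (σ ^ 2 / d.1) + Real.log (σ ^ 2 / d.2))) ''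
        {d : ℝ × ℝ | 0 < d.1 ∧ d.1 ≤ σ ^ 2 ∧ 0 < d.2 ∧ d.2 ≤ σ ^ 2 ∧ d.1 ≤ ε ∧ d.2 ≤ ε})
      = Real.log (σ ^ 2 / ε) ∧
    sInf ((fun d : ℝ × ℝ => (1 / 2) * (Real.log (σ ^ 2 / d.1) + Real.log (σ ^ 2 / d.2))) ''
        {d : ℝ × ℝ | 0 < d.1 ∧ d.1 ≤ σ ^ 2 ∧ 0 < d.2 ∧ d.2 ≤ σ ^ 2 ∧ d.1 ≤ ε ∧ d.2 ≤ ε ∧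
          d.1 + d.2 ≤ ε})
      = Real.log (2 * σ ^ 2 / ε) ∧
    sInf ((fun d : ℝ × ℝ => (1 / 2) * (Real.log (σ ^ 2 / d.1) + Real.log (σ ^ 2 / d.2))) ''
        {d : ℝ × ℝ | 0 < d.1 ∧ d.1 ≤ σ ^ 2 ∧ 0 < d.2 ∧ d.2 ≤ σ ^ 2 ∧ d.1 ≤ ε ∧ d.2 ≤ ε ∧
          d.1 + d.2 ≤ ε})
      - sInf ((fun d : ℝ × ℝ => (1 / 2) * (Real.log (σ ^ 2 / d.1) + Real.log (σ ^ 2 / d.2))) ''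
          {d : ℝ × ℝ | 0 < d.1 ∧ d.1 ≤ σ ^ 2 ∧ 0 < d.2 ∧ d.2 ≤ σ ^ 2 ∧ d.1 ≤ ε ∧ d.2 ≤ ε})
      = Real.log 2 := by
  have hs : 0 < σ ^ 2 := by positivity
  have e1 : Real.log (σ ^ 2 / ε) = Real.log (σ ^ 2) - Real.log ε :=
    Real.log_div hs.ne' hε.ne'
  have e2 : Real.log (2 * σ ^ 2 / ε) = Real.log 2 + Real.log (σ ^ 2) - Real.log ε := by
    rw [Real.log_div (by positivity) hε.ne', Real.log_mul (by norm_num) hs.ne']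
  have e3 : Real.log (ε / 2) = Real.log ε - Real.log 2 :=
    Real.log_div hε.ne' (by norm_num)
  have h1 : sInf ((fun d : ℝ × ℝ =>
        (1 / 2) * (Real.log (σ ^ 2 / d.1) + Real.log (σ ^ 2 / d.2))) ''
        {d : ℝ × ℝ | 0 < d.1 ∧ d.1 ≤ σ ^ 2 ∧ 0 < d.2 ∧ d.2 ≤ σ ^ 2 ∧ d.1 ≤ ε ∧ d.2 ≤ ε})
      = Real.log (σ ^ 2 / ε) := by
    apply IsLeast.csInf_eq
    constructor
    · exact ⟨(ε, ε), ⟨hε, hεσ.le, hε, hεσ.le, le_rfl, le_rfl⟩, by dsimp only; ring⟩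
    · rintro _ ⟨⟨a, b⟩, ⟨ha, -, hb, -, hae, hbe⟩, rfl⟩
      dsimp only at *
      rw [e1, Real.log_div hs.ne' ha.ne', Real.log_div hs.ne' hb.ne']
      have := Real.log_le_log ha hae
      have := Real.log_le_log hb hbe
      linarith
  have h2 : sInf ((fun d : ℝ × ℝ =>
        (1 / 2) * (Real.log (σ ^ 2 / d.1) + Real.log (σ ^ 2 / d.2))) ''
        {d : ℝ × ℝ | 0 < d.1 ∧ d.1 ≤ σ ^ 2 ∧ 0 < d.2 ∧ d.2 ≤ σ ^ 2 ∧ d.1 ≤ ε ∧ d.2 ≤ ε ∧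
          d.1 + d.2 ≤ ε})
      = Real.log (2 * σ ^ 2 / ε) := by
    apply IsLeast.csInf_eq
    constructor
    · refine ⟨(ε / 2, ε / 2), ⟨?_, ?_, ?_, ?_, ?_, ?_, ?_⟩, ?_⟩ <;> dsimp only
      any_goals linarith
      rw [e2, Real.log_div hs.ne' (by positivity), e3]
      ring
    · rintro _ ⟨⟨a, b⟩, ⟨ha, -, hb, -, -, -, hab⟩, rfl⟩
      dsimp only at *
      rw [e2, Real.log_div hs.ne' ha.ne', Real.log_div hs.ne' hb.ne']
      have hm : a * b ≤ (ε / 2) ^ 2 := by nlinarith [sq_nonneg (a - b)]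
      have hl := Real.log_le_log (mul_pos ha hb) hm
      rw [Real.log_mul ha.ne' hb.ne', Real.log_pow, e3] at hl
      push_cast at hl
      linarith
  refine ⟨h1, h2, ?_⟩
  rw [h1, h2, e1, e2]
  ring
end

section
/- Let (Ω, P) be a probability space, 𝒳 and 𝒵 standard Borel spaces, 𝒴 a standard Borel space, A a finite nonempty set, and ℓ : A → 𝒴 → ℝ with each ℓ(a,·) measurable and 0 ≤ ℓ ≤ C for a fixed constant C. Let X : Ω → 𝒳 and Y : Ω → 𝒴 be measurable and Z = f ∘ X for a measurable f : 𝒳 → 𝒵. Let Π^X and Π^Z denote the regular conditional distributions of Y given X and of Y given Z respectively. Then: (i) the excess Bayes answer risk equals the difference of expected posterior Bayes envelopes, inf over measurable φ : 𝒵 → A of E[ℓ(φ(Z), Y)] − inf over measurable ψ : 𝒳 → A of E[ℓ(ψ(X), Y)] = E[ min_{a ∈ A} ∫ ℓ(a, y) dΠ^Z(Z)(y) ] − E[ min_{a ∈ A} ∫ ℓ(a, y) dΠ^X(X)(y) ]; and (ii) this common value is nonnegative. -/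
open MeasureTheory ProbabilityTheory

lemma exists_measurable_argmin_aux {W A : Type*} [MeasurableSpace W] [Finite A] [Nonempty A]
    [MeasurableSpace A] (g : A → W → ℝ) (hg : ∀ a, Measurable (g a)) :
    ∃ φ : W → A, Measurable φ ∧ ∀ w, g (φ w) w = ⨅ a, g a w := by
  classical
  obtain ⟨s, hs⟩ := exists_surjective_nat A
  have hinf : Measurable fun w => ⨅ a, g a w := Measurable.iInf hg
  have hp : ∀ w, ∃ k : ℕ, g (s k) w = ⨅ a, g a w := by
    intro w
    obtain ⟨a, ha⟩ := exists_eq_ciInf_of_finite (f := fun a => g a w)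
    obtain ⟨k, rfl⟩ := hs a
    exact ⟨k, ha⟩
  refine ⟨fun w => s (Nat.find (hp w)), ?_, fun w => Nat.find_spec (hp w)⟩
  exact (measurable_from_nat (f := s)).comp
    (measurable_find hp fun k => measurableSet_eq_fun (hg (s k)) hinf)

lemma bayes_risk_eq_aux {Ω W 𝒴 : Type*} [MeasurableSpace Ω] [MeasurableSpace W]
    [MeasurableSpace 𝒴] [StandardBorelSpace 𝒴] [Nonempty 𝒴]
    (P : Measure Ω) [IsProbabilityMeasure P]
    (X : Ω → W) (Y : Ω → 𝒴) (hX : Measurable X) (hY : Measurable Y)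
    {A : Type*} [Finite A] [Nonempty A] [MeasurableSpace A] [MeasurableSingletonClass A]
    (ℓ : A → 𝒴 → ℝ) (hmeas : ∀ a, Measurable (ℓ a)) (C : ℝ)
    (hbd : ∀ a y, 0 ≤ ℓ a y ∧ ℓ a y ≤ C) :
    (⨅ ψ : {ψ : W → A // Measurable ψ}, ∫ ω, ℓ (ψ.1 (X ω)) (Y ω) ∂P)
      = ∫ ω, (⨅ a, ∫ y, ℓ a y ∂(condDistrib Y X P (X ω))) ∂P := by
  have hg : ∀ a, Measurable fun w => ∫ y, ℓ a y ∂(condDistrib Y X P w) := fun a =>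
    ((hmeas a).stronglyMeasurable.comp_measurable measurable_snd).integral_condDistrib.measurable
  have hunc : Measurable fun p : A × 𝒴 => ℓ p.1 p.2 :=
    measurable_from_prod_countable_right hmeas
  have key : ∀ ψ : W → A, Measurable ψ → ∫ ω, ℓ (ψ (X ω)) (Y ω) ∂P
      = ∫ ω, ∫ y, ℓ (ψ (X ω)) y ∂(condDistrib Y X P (X ω)) ∂P := by
    intro ψ hψ
    have hF : Measurable fun p : W × 𝒴 => ℓ (ψ p.1) p.2 :=
      hunc.comp ((hψ.comp measurable_fst).prodMk measurable_snd)
    have hint : Integrable (fun ω => ℓ (ψ (X ω)) (Y ω)) P :=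
      Integrable.of_bound (hF.comp (hX.prodMk hY)).aestronglyMeasurable C
        (.of_forall fun ω => by
          simp only [Real.norm_eq_abs]
          rw [abs_of_nonneg (hbd _ _).1]; exact (hbd _ _).2)
    have h := condExp_prod_ae_eq_integral_condDistrib (μ := P) hX hY.aemeasurable
      hF.stronglyMeasurable hint
    rw [← integral_congr_ae h, integral_condExp hX.comap_le]
  have hg0 : ∀ a w, 0 ≤ ∫ y, ℓ a y ∂(condDistrib Y X P w) := fun a w =>
    integral_nonneg fun y => (hbd a y).1
  have hgC : ∀ a w, ∫ y, ℓ a y ∂(condDistrib Y X P w) ≤ C := by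
    intro a w
    have h := norm_integral_le_of_norm_le_const (μ := condDistrib Y X P w) (f := ℓ a) (C := C)
      (.of_forall fun y => by rw [Real.norm_eq_abs, abs_of_nonneg (hbd _ _).1]; exact (hbd _ _).2)
    simp only [probReal_univ, mul_one] at h
    exact (le_abs_self _).trans h
  have hgint : ∀ ψ : W → A, Measurable ψ →
      Integrable (fun ω => ∫ y, ℓ (ψ (X ω)) y ∂(condDistrib Y X P (X ω))) P := by
    intro ψ hψ
    have hm : Measurable fun p : A × W => ∫ y, ℓ p.1 y ∂(condDistrib Y X P p.2) :=
      measurable_from_prod_countable_right hg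
    refine Integrable.of_bound
      (hm.comp ((hψ.comp hX).prodMk hX)).aestronglyMeasurable C (.of_forall fun ω => ?_)
    simp only [Real.norm_eq_abs]
    rw [abs_of_nonneg (hg0 _ _)]; exact hgC _ _
  obtain ⟨φ, hφ, hφmin⟩ := exists_measurable_argmin_aux _ hg
  have : Nonempty {ψ : W → A // Measurable ψ} := ⟨⟨φ, hφ⟩⟩
  simp_rw [← hφmin]
  apply le_antisymm
  · refine (ciInf_le ?_ ⟨φ, hφ⟩).trans (key φ hφ).le
    exact ⟨0, by rintro _ ⟨ψ, rfl⟩; exact integral_nonneg fun ω => (hbd _ _).1⟩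
  · refine le_ciInf fun ψ => ?_
    rw [key ψ.1 ψ.2]
    refine integral_mono (hgint φ hφ) (hgint ψ.1 ψ.2) fun ω => ?_
    simp only [hφmin]
    exact ciInf_le (Set.finite_range _).bddBelow (ψ.1 (X ω))


/-- **Restricted sufficiency–risk equivalence (per query).** For `Z = f ∘ X` a deterministic
compressed interface and a finite nonempty action set `A`: (i) the excess Bayes answer risk
of `Z` over `X` equals the difference of the expected posterior Bayes envelopes, and (ii) this
common value is nonnegative. Here `Π^X = condDistrib Y X P` and `Π^Z = condDistrib Y (f ∘ X) P`
are the regular conditional distributions of `Y` given `X` and given `Z`. -/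
theorem excess_risk_eq_envelope_gap {Ω 𝒳 𝒵 𝒴 : Type*}
    [MeasurableSpace Ω]
    [MeasurableSpace 𝒳] [StandardBorelSpace 𝒳]
    [MeasurableSpace 𝒵] [StandardBorelSpace 𝒵]
    [MeasurableSpace 𝒴] [StandardBorelSpace 𝒴] [Nonempty 𝒴]
    (P : Measure Ω) [IsProbabilityMeasure P]
    (X : Ω → 𝒳) (Y : Ω → 𝒴) (hX : Measurable X) (hY : Measurable Y)
    (f : 𝒳 → 𝒵) (hf : Measurable f)
    {A : Type*} [Finite A] [Nonempty A] [MeasurableSpace A] [MeasurableSingletonClass A]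
    (ℓ : A → 𝒴 → ℝ) (hmeas : ∀ a, Measurable (ℓ a)) (C : ℝ)
    (hbd : ∀ a y, 0 ≤ ℓ a y ∧ ℓ a y ≤ C) :
    ((⨅ φ : {φ : 𝒵 → A // Measurable φ}, ∫ ω, ℓ (φ.1 (f (X ω))) (Y ω) ∂P)
        - (⨅ ψ : {ψ : 𝒳 → A // Measurable ψ}, ∫ ω, ℓ (ψ.1 (X ω)) (Y ω) ∂P)
      = (∫ ω, (⨅ a, ∫ y, ℓ a y ∂(condDistrib Y (f ∘ X) P (f (X ω)))) ∂P)
        - ∫ ω, (⨅ a, ∫ y, ℓ a y ∂(condDistrib Y X P (X ω))) ∂P) ∧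
    0 ≤ (⨅ φ : {φ : 𝒵 → A // Measurable φ}, ∫ ω, ℓ (φ.1 (f (X ω))) (Y ω) ∂P)
        - (⨅ ψ : {ψ : 𝒳 → A // Measurable ψ}, ∫ ω, ℓ (ψ.1 (X ω)) (Y ω) ∂P) := by
  refine ⟨?_, ?_⟩
  · exact congrArg₂ (fun x y : ℝ => x - y)
      (bayes_risk_eq_aux P (f ∘ X) Y (hf.comp hX) hY ℓ hmeas C hbd)
      (bayes_risk_eq_aux P X Y hX hY ℓ hmeas C hbd)
  · have : Nonempty {φ : 𝒵 → A // Measurable φ} :=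
      ⟨⟨fun _ => Classical.arbitrary A, measurable_const⟩⟩
    rw [sub_nonneg]
    refine le_ciInf fun φ => ?_
    refine ciInf_le (f := fun ψ : {ψ : 𝒳 → A // Measurable ψ} => ∫ ω, ℓ (ψ.1 (X ω)) (Y ω) ∂P)
      ?_ ⟨φ.1 ∘ f, φ.2.comp hf⟩
    exact ⟨0, by rintro _ ⟨ψ, rfl⟩; exact integral_nonneg fun ω => (hbd _ _).1⟩
end

section
/- Let α, γ, V be finite types and let r : α × γ → ℝ be a joint pmf (nonnegative, summing to 1) with marginals r₁ x = ∑_z r(x, z) and r₂ z = ∑_x r(x, z). Define the mutual information I(r) = ∑_{x,z} r(x,z) · log( r(x,z) / (r₁ x · r₂ z) ), where terms with r(x,z) = 0 contribute 0 and log is the natural logarithm. Suppose there exist maps u : α → V and g : γ → V such that r(x, z) = 0 whenever u x ≠ g z (the common answer factor is exactly recoverable from each side), and let pV : V → ℝ be the induced law pV v = ∑_{x : u x = v} r₁ x. Then I(r) ≥ H(pV) = −∑_v pV v · log(pV v). -/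
/-- **Mutual information lower bound from exact recoverability of a common factor.** For a
joint pmf `r` on `α × γ` such that a common answer factor `V` is exactly recoverable from each
side (`r (x, z) = 0` whenever `u x ≠ g z`), the mutual information
`I(r) = ∑ x z, r (x,z) log (r (x,z) / (r₁ x * r₂ z))` is at least the entropy
`H(pV) = -∑ v, pV v * log (pV v)` of the induced law `pV v = ∑_{x : u x = v} r₁ x`. -/
theorem mutualInfo_ge_entropy_of_recoverable {α γ V : Type*}
    [Fintype α] [Fintype γ] [Fintype V] [DecidableEq V]
    (r : α × γ → ℝ) (hr0 : ∀ x, 0 ≤ r x) (hr1 : ∑ x, r x = 1)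
    (u : α → V) (g : γ → V)
    (hrec : ∀ x z, u x ≠ g z → r (x, z) = 0) :
    -∑ v, (∑ x ∈ Finset.univ.filter (fun x => u x = v), ∑ z, r (x, z)) *
        Real.log (∑ x ∈ Finset.univ.filter (fun x => u x = v), ∑ z, r (x, z))
      ≤ ∑ x, ∑ z, r (x, z) *
          Real.log (r (x, z) / ((∑ z', r (x, z')) * (∑ x', r (x', z)))) := by
  set a : α → ℝ := fun x => ∑ z, r (x, z) with ha
  set b : γ → ℝ := fun z => ∑ x, r (x, z) with hb
  set p : V → ℝ := fun v => ∑ x ∈ Finset.univ.filter (fun x => u x = v), ∑ z, r (x, z) with hp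
  have ha0 : ∀ x, 0 ≤ a x := fun x => Finset.sum_nonneg fun z _ => hr0 _
  have hb0 : ∀ z, 0 ≤ b z := fun z => Finset.sum_nonneg fun x _ => hr0 _
  have hp0 : ∀ v, 0 ≤ p v := fun v => Finset.sum_nonneg fun x _ => ha0 x
  have hra : ∀ x z, r (x, z) ≤ a x := fun x z =>
    Finset.single_le_sum (f := fun z => r (x, z)) (fun z _ => hr0 _) (Finset.mem_univ z)
  have hrb : ∀ x z, r (x, z) ≤ b z := fun x z =>
    Finset.single_le_sum (f := fun x => r (x, z)) (fun x _ => hr0 _) (Finset.mem_univ x)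
  have hap : ∀ x, a x ≤ p (u x) := fun x =>
    Finset.single_le_sum (f := a) (fun x _ => ha0 x) (by simp)
  have hpb : ∀ v, ∑ z, (if v = g z then b z else 0) = p v := by
    intro v
    have h1 : p v = ∑ x, ∑ z, (if v = g z then r (x, z) else 0) := by
      simp only [hp]
      rw [Finset.sum_filter]
      refine Finset.sum_congr rfl fun x _ => ?_
      by_cases h : u x = v
      · rw [if_pos h]
        refine Finset.sum_congr rfl fun z _ => ?_
        split_ifs with h2
        · rfl
        · exact hrec x z (by rwa [h])
      · rw [if_neg h]
        symm
        refine Finset.sum_eq_zero fun z _ => ?_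
        split_ifs with h2
        · exact hrec x z (by rwa [← h2])
        · rfl
    rw [h1, Finset.sum_comm]
    refine Finset.sum_congr rfl fun z _ => ?_
    split_ifs <;> simp [hb]
  have hsum : ∑ x, ∑ z, r (x, z) = 1 := by rw [← hr1, Fintype.sum_prod_type]
  have hL : ∑ v, p v * Real.log (p v) = ∑ x, ∑ z, r (x, z) * Real.log (p (u x)) := by
    have h1 : ∀ v, p v * Real.log (p v) =
        ∑ x ∈ Finset.univ.filter (fun x => u x = v), a x * Real.log (p (u x)) := by
      intro v
      have h2 : p v = ∑ x ∈ Finset.univ.filter (fun x => u x = v), a x := rfl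
      conv_lhs => rw [h2, Finset.sum_mul]
      refine Finset.sum_congr rfl fun x hx => ?_
      rw [← h2, (Finset.mem_filter.1 hx).2]
    rw [Finset.sum_congr rfl fun v _ => h1 v, Finset.sum_fiberwise]
    exact Finset.sum_congr rfl fun x _ => Finset.sum_mul _ _ _
  have key : ∀ x z, r (x, z) - a x / p (u x) * (if u x = g z then b z else 0) ≤
      r (x, z) * Real.log (r (x, z) / (a x * b z)) + r (x, z) * Real.log (p (u x)) := by
    intro x z
    rcases (hr0 (x, z)).eq_or_lt with h | h
    · rw [← h]
      have : 0 ≤ a x / p (u x) * (if u x = g z then b z else 0) :=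
        mul_nonneg (div_nonneg (ha0 x) (hp0 _)) (by split_ifs; exacts [hb0 z, le_rfl])
      simpa using this
    · have hug : u x = g z := by
        by_contra hne
        exact h.ne' (hrec x z hne)
      have hax := h.trans_le (hra x z)
      have hbz := h.trans_le (hrb x z)
      have hpx := hax.trans_le (hap x)
      rw [if_pos hug, ← mul_add, ← Real.log_mul (by positivity) hpx.ne']
      have h3 := Real.one_sub_inv_le_log_of_pos
        (show 0 < r (x, z) / (a x * b z) * p (u x) by positivity)
      have h4 := mul_le_mul_of_nonneg_left h3 h.le
      refine le_trans (le_of_eq ?_) h4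
      field_simp
  have hS : ∑ x, ∑ z, a x / p (u x) * (if u x = g z then b z else 0) ≤ 1 := by
    rw [← hsum]
    refine Finset.sum_le_sum fun x _ => ?_
    rw [← Finset.mul_sum, hpb]
    change a x / p (u x) * p (u x) ≤ a x
    by_cases h : p (u x) = 0
    · rw [h]; simpa using ha0 x
    · rw [div_mul_cancel₀ _ h]
  have hfin := Finset.sum_le_sum fun x (_ : x ∈ Finset.univ) =>
    Finset.sum_le_sum fun z (_ : z ∈ Finset.univ) => key x z
  simp only [Finset.sum_sub_distrib, Finset.sum_add_distrib] at hfin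
  rw [hsum, ← hL] at hfin
  change -∑ v, p v * Real.log (p v) ≤
    ∑ x, ∑ z, r (x, z) * Real.log (r (x, z) / (a x * b z))
  linarith
end
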